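/- arXiv:1310.6473 — 4 statements merged into one kernel-verified Lean document; each statement's English description precedes it below -/
import Mathlib

section
/- Let w ∈ S_n with E_{>0}(w) ≠ ∅, let i_0 be the smallest index such that {(p,q) : p > i_0, q > w(i_0)} ∩ E_{>0}(w) ≠ ∅, and set (p_0,q_0) = (i_0, w(i_0)). Then: (a) every (p,q) ∈ D(w) with p ≤ p_0 satisfies r_{p,q}(w) = 0; (b) every pair (p,q) ≠ (p_0,q_0) with p ≤ p_0 and q ≤ q_0 belongs to D(w); (c) the only pair (i,j) with i ≤ p_0, j ≤ q_0 and w(i) = j is (p_0,q_0), i.e., the only nonzero entry of the upper-left p_0 × q_0 submatrix of w is at position (p_0,q_0). -/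
/-! Setup: a permutation `w ∈ S_n` identified with its permutation matrix, 0-based
indexing via `Fin n`.  `rk w p q` is `r_{p,q}(w)`, `diagF w` is the diagram `D(w)`,
`essF w` the essential set `E(w)`, `essPosF w` is `E_{>0}(w)`. -/

variable {n : ℕ}

/-- `rk w p q` : the rank `r_{p,q}(w)`, i.e. the number of `i ≤ p` with `w i ≤ q`. -/
def rk (w : Equiv.Perm (Fin n)) (p q : Fin n) : ℕ :=
  (Finset.univ.filter fun i => i ≤ p ∧ w i ≤ q).card

/-- The diagram `D(w)`. -/
def diagF (w : Equiv.Perm (Fin n)) : Finset (Fin n × Fin n) :=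
  Finset.univ.filter fun pq => pq.2 < w pq.1 ∧ pq.1 < w⁻¹ pq.2

/-- The essential set `E(w)`. -/
def essF (w : Equiv.Perm (Fin n)) : Finset (Fin n × Fin n) :=
  (diagF w).filter fun pq =>
    (∀ p' : Fin n, (p' : ℕ) = (pq.1 : ℕ) + 1 → (p', pq.2) ∉ diagF w) ∧
    (∀ q' : Fin n, (q' : ℕ) = (pq.2 : ℕ) + 1 → (pq.1, q') ∉ diagF w)

/-- `E_{>0}(w)`. -/
def essPosF (w : Equiv.Perm (Fin n)) : Finset (Fin n × Fin n) :=
  (essF w).filter fun pq => 0 < rk w pq.1 pq.2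

theorem exists_mem_essF_ge (w : Equiv.Perm (Fin n)) {a : Fin n × Fin n} (ha : a ∈ diagF w) :
    ∃ b ∈ essF w, a ≤ b := by
  obtain ⟨b, hab, hb⟩ := (diagF w).exists_le_maximal ha
  refine ⟨b, Finset.mem_filter.2 ⟨hb.prop, fun p' hp' hmem => ?_, fun q' hq' hmem => ?_⟩, hab⟩
  · have hle : b ≤ (p', b.2) := ⟨Fin.le_def.2 (by simp [hp']), le_rfl⟩
    have hge : p' ≤ b.1 := (hb.le_of_ge hmem hle).1
    rw [Fin.le_def] at hge
    omega
  · have hle : b ≤ (b.1, q') := ⟨le_rfl, Fin.le_def.2 (by simp [hq'])⟩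
    have hge : q' ≤ b.2 := (hb.le_of_ge hmem hle).2
    rw [Fin.le_def] at hge
    omega

theorem rk_pos_iff (w : Equiv.Perm (Fin n)) (p q : Fin n) :
    0 < rk w p q ↔ ∃ i ≤ p, w i ≤ q := by
  simp [rk, Finset.card_pos, Finset.Nonempty]

/-- Let `i₀` be the smallest index such that
`{(p,q) : p > i₀, q > w(i₀)} ∩ E_{>0}(w) ≠ ∅`, and set `(p₀,q₀) = (i₀, w(i₀))`.  Then:
(a) every `(p,q) ∈ D(w)` with `p ≤ p₀` has `r_{p,q}(w) = 0`;
(b) every `(p,q) ≠ (p₀,q₀)` with `p ≤ p₀`, `q ≤ q₀` lies in `D(w)`;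
(c) the only nonzero entry of the upper-left `p₀ × q₀` corner of `w` is at `(p₀,q₀)`. -/
theorem msv_D_eq_zero_below_c (w : Equiv.Perm (Fin n)) (i₀ : Fin n)
    (h₁ : ∃ pq ∈ essPosF w, i₀ < pq.1 ∧ w i₀ < pq.2)
    (h₂ : ∀ i : Fin n, (∃ pq ∈ essPosF w, i < pq.1 ∧ w i < pq.2) → i₀ ≤ i) :
    (∀ pq ∈ diagF w, pq.1 ≤ i₀ → rk w pq.1 pq.2 = 0) ∧
    (∀ pq : Fin n × Fin n, pq ≠ (i₀, w i₀) → pq.1 ≤ i₀ → pq.2 ≤ w i₀ → pq ∈ diagF w) ∧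
    (∀ i j : Fin n, i ≤ i₀ → j ≤ w i₀ → w i = j → i = i₀ ∧ j = w i₀) := by
  have corner : ∀ i ≤ i₀, w i ≤ w i₀ → i = i₀ := by
    obtain ⟨pq, hpq, hp, hq⟩ := h₁
    exact fun i hi hwi => hi.antisymm (h₂ i ⟨pq, hpq, hi.trans_lt hp, hwi.trans_lt hq⟩)
  refine ⟨?_, ?_, ?_⟩
  · intro a ha hai
    by_contra hne
    obtain ⟨i, hip, hiq⟩ := (rk_pos_iff w _ _).1 (Nat.pos_of_ne_zero hne)
    obtain ⟨hwa, hwa'⟩ := (Finset.mem_filter.1 ha).2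
    have hip' : i < a.1 := hip.lt_of_ne fun h => (h ▸ hiq).not_gt hwa
    have hiq' : w i < a.2 := hiq.lt_of_ne fun h => by
      have hwi : a.1 < i := by simpa [← h] using hwa'
      exact hip.not_gt hwi
    obtain ⟨b, hb, hab⟩ := exists_mem_essF_ge w ha
    have hb' : b ∈ essPosF w :=
      Finset.mem_filter.2 ⟨hb, (rk_pos_iff w _ _).2 ⟨i, hip.trans hab.1, hiq.trans hab.2⟩⟩
    exact (h₂ i ⟨b, hb', hip'.trans_le hab.1, hiq'.trans_le hab.2⟩).not_gt (hip'.trans_le hai)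
  · rintro ⟨i, j⟩ hne hi hj
    refine Finset.mem_filter.2 ⟨Finset.mem_univ _, ?_, ?_⟩
    · by_contra! h
      obtain rfl := corner i hi (h.trans hj)
      exact hne (Prod.ext rfl (hj.antisymm h))
    · by_contra! h
      have hk : w⁻¹ j = i₀ := corner _ (h.trans hi) (by simpa using hj)
      exact hne (Prod.ext (hi.antisymm (hk ▸ h)) (Equiv.Perm.inv_eq_iff_eq.1 hk))
  · rintro i _ hi hj rfl
    obtain rfl := corner i hi hj
    exact ⟨rfl, rfl⟩
end

section
/- (Claim in the proof of Theorem 5.2) Let w ∈ S_n and (p,q) ∈ D(w) with r := r_{p,q}(w) > 0. Suppose that for every 1 ≤ i ≤ r, neither (p−i,q) nor (p,q−i) belongs to D(w). Then every pair (i,j) with i ≤ p, j ≤ q and w(i) = j satisfies p−r ≤ i ≤ p−1 and q−r ≤ j ≤ q−1; that is, the r×r submatrix w_{(p,q)} of w on rows p−r,…,p−1 and columns q−r,…,q−1 is a permutation matrix containing all r nonzero entries of the upper-left p×q submatrix of w. -/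
/-! Setup: a permutation `w ∈ S_n` identified with its permutation matrix, 0-based
indexing via `Fin n`.  `rk w p q` is `r_{p,q}(w)` and `diagF w` is the diagram
`D(w)`.  "`(p−i,q) ∉ D(w)`" is expressed by quantifying over the `p' : Fin n`
with `p' + i = p` (similarly for columns).  The conclusion "every nonzero entry
`(i,j)` of the upper-left `p×q` corner satisfies `p−r ≤ i ≤ p−1` and
`q−r ≤ j ≤ q−1`" is expressed via `p ≤ i + r ∧ i < p ∧ q ≤ j + r ∧ j < q`, and
"`w_{(p,q)}` is a permutation matrix" by the existence of `v ∈ S_r` with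
`w(p−r+a) = q−r+v(a)` for all `a`. -/

variable {n : ℕ}

variable {n : ℕ}

theorem rk_inv (w : Equiv.Perm (Fin n)) (p q : Fin n) : rk w⁻¹ q p = rk w p q := by
  unfold rk
  refine Finset.card_bij (fun j _ => w⁻¹ j) ?_ (fun _ _ _ _ h => w⁻¹.injective h) ?_
  · intro j hj
    simpa [and_comm] using hj
  · intro i hi
    exact ⟨w i, by simpa [and_comm] using hi, by simp⟩

theorem mem_diagF_inv (w : Equiv.Perm (Fin n)) (p q : Fin n) :
    (q, p) ∈ diagF w⁻¹ ↔ (p, q) ∈ diagF w := by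
  simp [diagF, and_comm]

theorem rk_le_of_lt (w : Equiv.Perm (Fin n)) (p q : Fin n) (h : q < w p) :
    rk w p q ≤ (p : ℕ) := by
  rw [← Fin.card_Iio p]
  refine Finset.card_le_card fun i hi => ?_
  simp only [Finset.mem_filter, Finset.mem_univ, true_and] at hi
  refine Finset.mem_Iio.2 (lt_of_le_of_ne hi.1 ?_)
  rintro rfl
  exact absurd hi.2 (not_le.2 h)

/-- If none of the `r_{p,q}(w)` positions directly above `(p, q) ∈ D(w)` lies in the diagram, then
the rows of the nonzero entries weakly northwest of `(p, q)` are exactly the `r_{p,q}(w)` rows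
preceding `p`. -/
theorem le_and_le_iff_of_notMem_diagF (w : Equiv.Perm (Fin n)) (p q : Fin n)
    (hD : (p, q) ∈ diagF w)
    (hrow : ∀ i : ℕ, 1 ≤ i → i ≤ rk w p q →
      ∀ p' : Fin n, (p' : ℕ) + i = (p : ℕ) → (p', q) ∉ diagF w) (i : Fin n) :
    (i ≤ p ∧ w i ≤ q) ↔ ((p : ℕ) ≤ (i : ℕ) + rk w p q ∧ i < p) := by
  have hD' : q < w p ∧ p < w⁻¹ q := by simpa [diagF] using hD
  have hle := rk_le_of_lt w p q hD'.1
  let a : Fin n := ⟨(p : ℕ) - rk w p q, by omega⟩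
  have hmem (k : Fin n) : k ∈ Finset.Ico a p ↔ ((p : ℕ) ≤ (k : ℕ) + rk w p q ∧ k < p) := by
    simp only [Finset.mem_Ico, a, Fin.le_def]
    omega
  have hsub : Finset.Ico a p ⊆ Finset.univ.filter fun k => k ≤ p ∧ w k ≤ q := by
    intro k hk
    obtain ⟨h1, h2⟩ := (hmem k).1 hk
    have hk' := hrow ((p : ℕ) - k) (by omega) (by omega) k (by omega)
    simp only [diagF, Finset.mem_filter, Finset.mem_univ, true_and, not_and] at hk'
    simp only [Finset.mem_filter, Finset.mem_univ, true_and]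
    exact ⟨h2.le, not_lt.1 fun h => hk' h (h2.trans hD'.2)⟩
  have hcard : (Finset.univ.filter fun k => k ≤ p ∧ w k ≤ q).card ≤ (Finset.Ico a p).card := by
    change rk w p q ≤ _
    rw [Fin.card_Ico]
    simp only [a]
    omega
  have heq := Finset.eq_of_subset_of_card_le hsub hcard
  rw [← hmem, heq]
  simp

/-- Claim in the proof of Theorem 5.2: if `(p,q) ∈ D(w)` with `r = r_{p,q}(w) > 0`
and for every `1 ≤ i ≤ r` neither `(p−i,q)` nor `(p,q−i)` is in `D(w)`, then all
nonzero entries of the upper-left `p×q` corner of `w` lie in the `r×r` box on rows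
`p−r,…,p−1` and columns `q−r,…,q−1`; that is, `w_{(p,q)}` is a permutation matrix
containing all `r` of them. -/
theorem submatrix_is_permutation (w : Equiv.Perm (Fin n)) (p q : Fin n)
    (hD : (p, q) ∈ diagF w) (hr : 0 < rk w p q)
    (hrow : ∀ i : ℕ, 1 ≤ i → i ≤ rk w p q →
      ∀ p' : Fin n, (p' : ℕ) + i = (p : ℕ) → (p', q) ∉ diagF w)
    (hcol : ∀ i : ℕ, 1 ≤ i → i ≤ rk w p q →
      ∀ q' : Fin n, (q' : ℕ) + i = (q : ℕ) → (p, q') ∉ diagF w) :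
    (∀ i j : Fin n, i ≤ p → j ≤ q → w i = j →
      (p : ℕ) ≤ (i : ℕ) + rk w p q ∧ i < p ∧ (q : ℕ) ≤ (j : ℕ) + rk w p q ∧ j < q) ∧
    (∃ v : Equiv.Perm (Fin (rk w p q)),
      ∀ (i : Fin n) (a : Fin (rk w p q)),
        (i : ℕ) = (p : ℕ) - rk w p q + (a : ℕ) →
          (w i : ℕ) + rk w p q = (q : ℕ) + (v a : ℕ)) := by
  have hlt : q < w p ∧ p < w⁻¹ q := by simpa [diagF] using hD
  have hrow_iff := le_and_le_iff_of_notMem_diagF w p q hD hrow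
  have hcol_iff := le_and_le_iff_of_notMem_diagF w⁻¹ q p ((mem_diagF_inv w p q).2 hD) (by
    intro i h1 h2 q' hq'
    rw [rk_inv] at h2
    rw [mem_diagF_inv]
    exact hcol i h1 h2 q' hq')
  rw [rk_inv] at hcol_iff
  have hp := rk_le_of_lt w p q hlt.1
  have hbox (i j : Fin n) (hi : i ≤ p) (hj : j ≤ q) (hij : w i = j) :
      (p : ℕ) ≤ (i : ℕ) + rk w p q ∧ i < p ∧ (q : ℕ) ≤ (j : ℕ) + rk w p q ∧ j < q := by
    subst hij
    obtain ⟨h1, h2⟩ := (hrow_iff i).1 ⟨hi, hj⟩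
    obtain ⟨h3, h4⟩ := (hcol_iff (w i)).1 ⟨hj, by simpa using hi⟩
    exact ⟨h1, h2, h3, h4⟩
  refine ⟨hbox, ?_⟩
  let row (a : Fin (rk w p q)) : Fin n := ⟨(p : ℕ) - rk w p q + a, by omega⟩
  have hval (a : Fin (rk w p q)) :
      (q : ℕ) ≤ (w (row a) : ℕ) + rk w p q ∧ (w (row a) : ℕ) < q := by
    obtain ⟨h1, h2⟩ := (hrow_iff (row a)).2
      ⟨by simp only [row]; omega, by simp only [row, Fin.lt_def]; omega⟩
    exact (hbox _ _ h1 h2 rfl).2.2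
  let f (a : Fin (rk w p q)) : Fin (rk w p q) :=
    ⟨(w (row a) : ℕ) + rk w p q - q, by have := hval a; omega⟩
  have hf : Function.Injective f := by
    intro a b hab
    have ha := hval a
    have hb := hval b
    simp only [f, Fin.mk.injEq] at hab
    have hrows : row a = row b := w.injective (Fin.ext (by omega))
    simp only [row, Fin.mk.injEq] at hrows
    exact Fin.ext (by omega)
  refine ⟨Equiv.ofBijective f (Finite.injective_iff_bijective.1 hf), fun i a hia => ?_⟩
  obtain rfl : i = row a := Fin.ext hia
  have := hval a
  simp only [Equiv.ofBijective_apply, f]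
  omega
end

section
/- (Claim in the proof of Theorem 5.2) Let w ∈ S_n and (p,q) ∈ D(w) with r := r_{p,q}(w) > 0, and suppose every pair (i,j) with i ≤ p, j ≤ q and w(i) = j satisfies p−r ≤ i ≤ p−1 and q−r ≤ j ≤ q−1. Then every minor of size r+1 of the upper-left p×q submatrix X_{[p,q]} of X, other than det X̄_{(p,q)}, lies in the ideal of K[X] generated by the variables x_{s,t} with s ≤ p, t ≤ q and r_{s,t}(w) = 0. -/
/-! Setup: `K` a field, `K[X] = MvPolynomial (Fin n × Fin n) K` the polynomial ring
on the entries of the generic `n × n` matrix `X`, `w ∈ S_n` a permutation (0-based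
indexing via `Fin n`).  `rk w p q` is `r_{p,q}(w)` and `diagF w` is `D(w)`.  A
minor of size `r+1` of `X_{[p,q]}` is the determinant of the submatrix of `X` on
strictly increasing rows `ρ` and columns `γ` bounded by `p`, `q`; the minor
`det X̄_{(p,q)}` is the one with `ρ a = p−r+a`, `γ b = q−r+b`.  The box hypothesis
"every nonzero entry `(i,j)` of the upper-left `p×q` corner satisfies
`p−r ≤ i ≤ p−1`, `q−r ≤ j ≤ q−1`" is expressed via
`p ≤ i + r ∧ i < p ∧ q ≤ j + r ∧ j < q`. -/

variable {n : ℕ}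

variable {n : ℕ}

theorem strictMono_fin_val_add_sub_le {m : ℕ} {f : Fin m → Fin n} (hf : StrictMono f)
    {a b : Fin m} (hab : a ≤ b) : (f a : ℕ) + ((b : ℕ) - a) ≤ f b := by
  obtain ⟨b, hb⟩ := b
  induction b with
  | zero =>
    obtain rfl : a = ⟨0, hb⟩ := Fin.ext (Nat.le_zero.mp hab)
    simp
  | succ k ih =>
    rcases hab.eq_or_lt with rfl | h
    · simp
    · have h' : (a : ℕ) < k + 1 := h
      have h₁ := ih (by omega) (Fin.le_def.mpr (Nat.lt_succ_iff.mp h'))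
      have h₂ : (f ⟨k, by omega⟩ : ℕ) < f ⟨k + 1, hb⟩ :=
        hf (Fin.lt_def.mpr (Nat.lt_succ_self k))
      simp only at h₁ ⊢
      omega

theorem strictMono_fin_val_eq_or_zero_add_lt {r : ℕ} {f : Fin (r + 1) → Fin n}
    (hf : StrictMono f) {p : Fin n} (hp : ∀ a, f a ≤ p) :
    (∀ a, (f a : ℕ) = (p : ℕ) - r + (a : ℕ)) ∨ (f 0 : ℕ) + r < p := by
  refine or_iff_not_imp_right.mpr fun h a => ?_
  have h₁ := strictMono_fin_val_add_sub_le hf (Fin.zero_le a)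
  have h₂ := strictMono_fin_val_add_sub_le hf (Fin.le_last a)
  have h₃ : (f (Fin.last r) : ℕ) ≤ p := hp _
  have h₄ := a.isLt
  simp only [Fin.val_zero, Fin.val_last] at h₁ h₂
  omega

theorem rk_eq_zero {w : Equiv.Perm (Fin n)} {p q : Fin n}
    (h : ∀ i, i ≤ p → ¬ w i ≤ q) : rk w p q = 0 := by
  simpa [rk, Finset.filter_eq_empty_iff] using h

theorem Matrix.det_mem_of_row_zero_mem {R : Type*} [CommRing R] {m : ℕ}
    (M : Matrix (Fin (m + 1)) (Fin (m + 1)) R) {I : Ideal R} (h : ∀ j, M 0 j ∈ I) :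
    M.det ∈ I := by
  rw [Matrix.det_succ_row_zero]
  exact I.sum_mem fun j _ => I.mul_mem_right _ (I.mul_mem_left _ (h j))

/-- Claim in the proof of Theorem 5.2: under the box hypothesis on `(p,q) ∈ D(w)`
with `r = r_{p,q}(w) > 0`, every `(r+1)`-minor of `X_{[p,q]}` other than
`det X̄_{(p,q)}` lies in the ideal generated by the variables `x_{s,t}` with
`s ≤ p`, `t ≤ q`, `r_{s,t}(w) = 0`. -/
theorem minor_mem_rank_zero_variables (K : Type*) [Field K]
    (w : Equiv.Perm (Fin n)) (p q : Fin n)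
    (hD : (p, q) ∈ diagF w) (hr : 0 < rk w p q)
    (hbox : ∀ i j : Fin n, i ≤ p → j ≤ q → w i = j →
      (p : ℕ) ≤ (i : ℕ) + rk w p q ∧ i < p ∧ (q : ℕ) ≤ (j : ℕ) + rk w p q ∧ j < q)
    (ρ γ : Fin (rk w p q + 1) → Fin n) (hρ : StrictMono ρ) (hγ : StrictMono γ)
    (hρp : ∀ a, ρ a ≤ p) (hγq : ∀ b, γ b ≤ q)
    (hne : ¬((∀ a, (ρ a : ℕ) = (p : ℕ) - rk w p q + (a : ℕ)) ∧
             (∀ b, (γ b : ℕ) = (q : ℕ) - rk w p q + (b : ℕ)))) :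
    ((Matrix.of fun a b => (MvPolynomial.X (ρ a, γ b) :
        MvPolynomial (Fin n × Fin n) K)).det) ∈
      Ideal.span {f : MvPolynomial (Fin n × Fin n) K |
        ∃ s t : Fin n, s ≤ p ∧ t ≤ q ∧ rk w s t = 0 ∧ f = MvPolynomial.X (s, t)} := by
  rw [not_and_or] at hne
  rcases hne with h | h
  · have h₀ := (strictMono_fin_val_eq_or_zero_add_lt hρ hρp).resolve_left h
    refine Matrix.det_mem_of_row_zero_mem _ fun b => Ideal.subset_span
      ⟨ρ 0, γ b, hρp 0, hγq b, rk_eq_zero fun i hi hw => ?_, rfl⟩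
    have h₁ := (hbox i (w i) (hi.trans (hρp 0)) (hw.trans (hγq b)) rfl).1
    have h₂ : (i : ℕ) ≤ ρ 0 := hi
    omega
  · have h₀ := (strictMono_fin_val_eq_or_zero_add_lt hγ hγq).resolve_left h
    rw [← Matrix.det_transpose]
    refine Matrix.det_mem_of_row_zero_mem _ fun a => Ideal.subset_span
      ⟨ρ a, γ 0, hρp a, hγq 0, rk_eq_zero fun i hi hw => ?_, rfl⟩
    have h₁ := (hbox i (w i) (hi.trans (hρp a)) (hw.trans (hγq 0)) rfl).2.2.1
    have h₂ : (w i : ℕ) ≤ γ 0 := hw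
    omega
end

section
/- (Diagram decomposition in the proof of Theorem 5.2) Let w ∈ S_n and suppose that for every (p,q) ∈ D_{>0}(w), writing r = r_{p,q}(w), every pair (i,j) with i ≤ p, j ≤ q, w(i) = j satisfies p−r ≤ i ≤ p−1 and q−r ≤ j ≤ q−1 (so each w_{(p,q)} is a permutation matrix). Let (p_1,q_1),…,(p_t,q_t) be the maximal elements of D_{>0}(w) with respect to the componentwise order, r_i = r_{p_i,q_i}(w), w_i = w_{(p_i,q_i)}, and 𝒲_i = {(p_i−r_i−1+a, q_i−r_i−1+b) : (a,b) ∈ D(w_i)}. Then D(w) is the disjoint union of the three sets: D_{=0}(w) \ (𝒲_1 ∪ ⋯ ∪ 𝒲_t); the pairwise disjoint sets 𝒲_1,…,𝒲_t; and {(p_1,q_1),…,(p_t,q_t)}. -/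
/-! Setup: a permutation `w ∈ S_n` identified with its permutation matrix, 0-based
indexing via `Fin n`.  `rk w p q` is `r_{p,q}(w)` and `diagF w` is the diagram
`D(w)` (defined uniformly for permutations of any size).  For each maximal element
`pq = (p_i,q_i)` of `D_{>0}(w)`, `V pq ∈ S_{r_i}` is the permutation matrix
`w_i = w_{(p_i,q_i)}` (encoded by `w(p_i−r_i+a) = q_i−r_i+(V pq)(a)`), and
`W pq = 𝒲_i` is the translate of `D(w_i)` into `D(w)`. -/

open scoped Classical

variable {n : ℕ}

variable {n : ℕ}

theorem mem_diagF {w : Equiv.Perm (Fin n)} {x : Fin n × Fin n} :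
    x ∈ diagF w ↔ x.2 < w x.1 ∧ x.1 < w⁻¹ x.2 := by
  simp [diagF]

/-- If all entries weakly northwest of `(p, q)` lie in rows above `p`, the rank is at most `p`. -/
theorem rk_le_row {w : Equiv.Perm (Fin n)} {p q : Fin n}
    (h : ∀ i, i ≤ p → w i ≤ q → i < p) : rk w p q ≤ p := by
  rw [← Fin.card_Iio p]
  refine Finset.card_le_card fun i hi => ?_
  simp only [Finset.mem_filter, Finset.mem_univ, true_and] at hi
  exact Finset.mem_Iio.2 (h i hi.1 hi.2)

/-- If all entries weakly northwest of `(p, q)` lie in columns left of `q`, the rank is at most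
`q`. -/
theorem rk_le_col {w : Equiv.Perm (Fin n)} {p q : Fin n}
    (h : ∀ i, i ≤ p → w i ≤ q → w i < q) : rk w p q ≤ q := by
  rw [← Fin.card_Iio q]
  refine Finset.card_le_card_of_injOn w (fun i hi => ?_) w.injective.injOn
  simp only [Finset.coe_filter, Finset.mem_univ, true_and, Set.mem_ofPred_eq] at hi
  exact Finset.mem_coe.2 (Finset.mem_Iio.2 (h i hi.1 hi.2))

theorem exists_of_rk_pos {w : Equiv.Perm (Fin n)} {p q : Fin n} (h : 0 < rk w p q) :
    ∃ i, i ≤ p ∧ w i ≤ q := by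
  obtain ⟨i, hi⟩ := Finset.card_pos.1 h
  exact ⟨i, by simpa using hi⟩

/-- The rows `p - r, …, p - 1` and columns `q - r, …, q - 1` of `w` form the permutation matrix of
`v`. -/
def IsBlock (w : Equiv.Perm (Fin n)) (p q r : ℕ) (v : Equiv.Perm (Fin r)) : Prop :=
  ∀ (i : Fin n) (a : Fin r), (i : ℕ) = p - r + a → (w i : ℕ) + r = q + v a

namespace IsBlock

variable {w : Equiv.Perm (Fin n)} {p q r : ℕ} {v : Equiv.Perm (Fin r)}

theorem exists_of_row (h : IsBlock w p q r v) (hp : r ≤ p) {i : Fin n} (h₁ : p ≤ i + r)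
    (h₂ : (i : ℕ) < p) : ∃ a : Fin r, (i : ℕ) = p - r + a ∧ (w i : ℕ) + r = q + v a := by
  have hi : (i : ℕ) = p - r + (⟨i + r - p, by omega⟩ : Fin r) := by simp only; omega
  exact ⟨_, hi, h i _ hi⟩

theorem apply_lt (h : IsBlock w p q r v) (hp : r ≤ p) {i : Fin n} (h₁ : p ≤ i + r)
    (h₂ : (i : ℕ) < p) : (w i : ℕ) < q := by
  obtain ⟨a, -, ha⟩ := h.exists_of_row hp h₁ h₂
  have := (v a).isLt
  omega

theorem inv_apply_eq (h : IsBlock w p q r v) (hp : r ≤ p) (hpn : p ≤ n) {j : Fin n} {b : Fin r}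
    (hj : (j : ℕ) + r = q + b) : (w⁻¹ j : ℕ) = p - r + (v⁻¹ b : Fin r) := by
  have hlt : p - r + (v⁻¹ b : Fin r) < n := by have := (v⁻¹ b).isLt; omega
  have hw := h ⟨_, hlt⟩ (v⁻¹ b) rfl
  rw [← Equiv.Perm.mul_apply, mul_inv_cancel, Equiv.Perm.one_apply] at hw
  have hwj : w ⟨_, hlt⟩ = j := Fin.ext (by omega)
  rw [← hwj, ← Equiv.Perm.mul_apply, inv_mul_cancel, Equiv.Perm.one_apply]

theorem inv_apply_lt (h : IsBlock w p q r v) (hp : r ≤ p) (hpn : p ≤ n) {j : Fin n}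
    (h₁ : q ≤ j + r) (h₂ : (j : ℕ) < q) : (w⁻¹ j : ℕ) < p := by
  have hb := h.inv_apply_eq hp hpn (b := ⟨j + r - q, by omega⟩) (j := j) (by simp only; omega)
  have := (v⁻¹ (⟨j + r - q, by omega⟩ : Fin r)).isLt
  omega

theorem mem_diagF_iff (h : IsBlock w p q r v) (hp : r ≤ p) (hq : r ≤ q) (hpn : p ≤ n)
    {i j : Fin n} {a b : Fin r} (hi : (i : ℕ) = p - r + a) (hj : (j : ℕ) = q - r + b) :
    (i, j) ∈ diagF w ↔ (a, b) ∈ diagF v := by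
  have hw := h i a hi
  have hw' := h.inv_apply_eq hp hpn (j := j) (b := b) (by omega)
  simp only [mem_diagF, Fin.lt_def]
  omega

end IsBlock

/-- Diagram decomposition in the proof of Theorem 5.2: if every nonzero entry of each
upper-left `p×q` corner with `(p,q) ∈ D_{>0}(w)` lies in the corresponding `r×r`
box (so each `w_{(p,q)}` is a permutation matrix), then, denoting by `Mx` the set
of maximal elements of `D_{>0}(w)` for the componentwise order, `D(w)` is the
disjoint union of `D_{=0}(w) ∖ (𝒲_1 ∪ ⋯ ∪ 𝒲_t)`, the pairwise disjoint sets
`𝒲_1, …, 𝒲_t`, and `{(p_1,q_1),…,(p_t,q_t)}`. -/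
theorem diagram_decomposition (w : Equiv.Perm (Fin n))
    (hbox : ∀ pq ∈ (diagF w).filter fun x => 0 < rk w x.1 x.2,
      ∀ i j : Fin n, i ≤ pq.1 → j ≤ pq.2 → w i = j →
        (pq.1 : ℕ) ≤ (i : ℕ) + rk w pq.1 pq.2 ∧ i < pq.1 ∧
        (pq.2 : ℕ) ≤ (j : ℕ) + rk w pq.1 pq.2 ∧ j < pq.2)
    (Mx : Finset (Fin n × Fin n))
    (hMx : Mx = ((diagF w).filter fun x => 0 < rk w x.1 x.2).filter fun pq =>
      ∀ pq' ∈ (diagF w).filter fun x => 0 < rk w x.1 x.2,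
        pq.1 ≤ pq'.1 → pq.2 ≤ pq'.2 → pq = pq')
    (V : (pq : Fin n × Fin n) → Equiv.Perm (Fin (rk w pq.1 pq.2)))
    (hV : ∀ pq ∈ Mx, ∀ (i : Fin n) (a : Fin (rk w pq.1 pq.2)),
      (i : ℕ) = (pq.1 : ℕ) - rk w pq.1 pq.2 + (a : ℕ) →
        (w i : ℕ) + rk w pq.1 pq.2 = (pq.2 : ℕ) + (V pq a : ℕ))
    (W : Fin n × Fin n → Finset (Fin n × Fin n))
    (hW : ∀ pq, W pq = Finset.univ.filter fun ij : Fin n × Fin n =>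
      ∃ a b : Fin (rk w pq.1 pq.2), (a, b) ∈ diagF (V pq) ∧
        (ij.1 : ℕ) = (pq.1 : ℕ) - rk w pq.1 pq.2 + (a : ℕ) ∧
        (ij.2 : ℕ) = (pq.2 : ℕ) - rk w pq.1 pq.2 + (b : ℕ)) :
    diagF w =
      ((((diagF w).filter fun x => rk w x.1 x.2 = 0) \ Mx.biUnion W) ∪
        Mx.biUnion W) ∪ Mx ∧
    (∀ pq₁ ∈ Mx, ∀ pq₂ ∈ Mx, pq₁ ≠ pq₂ → Disjoint (W pq₁) (W pq₂)) ∧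
    Disjoint (((diagF w).filter fun x => rk w x.1 x.2 = 0) \ Mx.biUnion W)
      (Mx.biUnion W) ∧
    Disjoint (((diagF w).filter fun x => rk w x.1 x.2 = 0) \ Mx.biUnion W) Mx ∧
    Disjoint (Mx.biUnion W) Mx := by
  set S := (diagF w).filter fun x => 0 < rk w x.1 x.2 with hS
  have memMx : ∀ x, x ∈ Mx ↔ x ∈ S ∧ ∀ y ∈ S, x.1 ≤ y.1 → x.2 ≤ y.2 → x = y := fun x => by
    rw [hMx, Finset.mem_filter]
  have memS : ∀ x, x ∈ S ↔ x ∈ diagF w ∧ 0 < rk w x.1 x.2 := fun x => by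
    rw [hS, Finset.mem_filter]
  have hrow : ∀ x ∈ S, rk w x.1 x.2 ≤ x.1 := fun x hx =>
    rk_le_row fun i hi hj => (hbox x hx i _ hi hj rfl).2.1
  have hcol : ∀ x ∈ S, rk w x.1 x.2 ≤ x.2 := fun x hx =>
    rk_le_col fun i hi hj => (hbox x hx i _ hi hj rfl).2.2.2
  have hblock : ∀ x ∈ Mx, IsBlock w x.1 x.2 (rk w x.1 x.2) (V x) := hV
  have memS_of_Mx : ∀ x ∈ Mx, x ∈ S := fun x hx => ((memMx x).1 hx).1
  have memW : ∀ x ∈ Mx, ∀ y : Fin n × Fin n, y ∈ W x ↔ y ∈ diagF w ∧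
      ((x.1 : ℕ) ≤ y.1 + rk w x.1 x.2 ∧ y.1 < x.1) ∧
      ((x.2 : ℕ) ≤ y.2 + rk w x.1 x.2 ∧ y.2 < x.2) := by
    intro x hx y
    have hp := hrow x (memS_of_Mx x hx)
    have hq := hcol x (memS_of_Mx x hx)
    have hiff := fun a b => (hblock x hx).mem_diagF_iff hp hq x.1.isLt.le
      (i := y.1) (j := y.2) (a := a) (b := b)
    simp only [hW, Finset.mem_filter, Finset.mem_univ, true_and, Fin.lt_def]
    constructor
    · rintro ⟨a, b, hab, hi, hj⟩
      exact ⟨(hiff a b hi hj).2 hab, by omega, by omega⟩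
    · rintro ⟨hy, hi, hj⟩
      have hi' : (y.1 : ℕ) = x.1 - rk w x.1 x.2 +
          (⟨y.1 + rk w x.1 x.2 - x.1, by omega⟩ : Fin (rk w x.1 x.2)) := by simp only; omega
      have hj' : (y.2 : ℕ) = x.2 - rk w x.1 x.2 +
          (⟨y.2 + rk w x.1 x.2 - x.2, by omega⟩ : Fin (rk w x.1 x.2)) := by simp only; omega
      exact ⟨_, _, (hiff _ _ hi' hj').1 hy, hi', hj'⟩
  have hcover : ∀ y ∈ S, y ∉ Mx → ∃ x ∈ Mx, y ∈ W x := by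
    intro y hy hyM
    obtain ⟨x, hyx, hxmax⟩ := S.exists_le_maximal hy
    have hx : x ∈ Mx := (memMx x).2 ⟨hxmax.prop, fun z hz h₁ h₂ =>
      le_antisymm (show x ≤ z from ⟨h₁, h₂⟩) (hxmax.2 hz ⟨h₁, h₂⟩)⟩
    have hp := hrow x hxmax.prop
    obtain ⟨hyD, hypos⟩ := (memS y).1 hy
    obtain ⟨i, hi, hj⟩ := exists_of_rk_pos hypos
    have hiy := hbox y hy i _ hi hj rfl
    have hix := hbox x hxmax.prop i _ (hi.trans hyx.1) (hj.trans hyx.2) rfl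
    have hyw := mem_diagF.1 hyD
    have hle₁ : y.1 ≤ x.1 := hyx.1
    have hle₂ : y.2 ≤ x.2 := hyx.2
    simp only [Fin.lt_def, Fin.le_def] at hiy hix hyw hle₁ hle₂
    have hlt₁ : (y.1 : ℕ) < x.1 := by
      by_contra hne
      have hlt₂ : (y.2 : ℕ) < x.2 := by
        by_contra hne'
        have hxy : x = y := Prod.ext (Fin.ext (by omega)) (Fin.ext (by omega))
        exact hyM (hxy ▸ hx)
      have := (hblock x hx).inv_apply_lt hp x.1.isLt.le (j := y.2) (by omega) hlt₂
      omega
    have := (hblock x hx).apply_lt hp (i := y.1) (by omega) hlt₁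
    exact ⟨x, hx, (memW x hx y).2 ⟨hyD, ⟨by omega, hlt₁⟩, by omega, Fin.lt_def.2 (by omega)⟩⟩
  have hdisj : ∀ x ∈ Mx, ∀ y ∈ Mx, x.1 < y.1 → Disjoint (W x) (W y) := by
    intro x hx y hy hxy
    refine Finset.disjoint_left.2 fun z hzx hzy => ?_
    have hzx := (memW x hx z).1 hzx
    have hzy := (memW y hy z).1 hzy
    have hxw := mem_diagF.1 ((memS x).1 (memS_of_Mx x hx)).1
    have hlt : y.2 < x.2 := by
      by_contra! hle
      exact hxy.ne (congrArg Prod.fst (((memMx x).1 hx).2 y (memS_of_Mx y hy) hxy.le hle))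
    simp only [Fin.lt_def] at hzx hzy hxw hlt hxy
    have := (hblock y hy).apply_lt (hrow y (memS_of_Mx y hy)) (i := x.1) (by omega) hxy
    omega
  refine ⟨?_, ?_, Finset.sdiff_disjoint, ?_, ?_⟩
  · ext y
    simp only [Finset.mem_union, Finset.mem_sdiff, Finset.mem_filter, Finset.mem_biUnion]
    constructor
    · intro hy
      by_cases hyW : ∃ x ∈ Mx, y ∈ W x
      · exact .inl (.inr hyW)
      by_cases hyM : y ∈ Mx
      · exact .inr hyM
      refine .inl (.inl ⟨⟨hy, ?_⟩, hyW⟩)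
      by_contra h0
      exact hyW (hcover y ((memS y).2 ⟨hy, Nat.pos_of_ne_zero h0⟩) hyM)
    · rintro ((⟨⟨hy, -⟩, -⟩ | ⟨x, hx, hy⟩) | hy)
      · exact hy
      · exact ((memW x hx y).1 hy).1
      · exact ((memS y).1 (memS_of_Mx y hy)).1
  · intro x hx y hy hne
    rcases lt_trichotomy x.1 y.1 with h | h | h
    · exact hdisj x hx y hy h
    · refine absurd ?_ hne
      rcases le_total x.2 y.2 with h' | h'
      · exact ((memMx x).1 hx).2 y (memS_of_Mx y hy) h.le h'
      · exact (((memMx y).1 hy).2 x (memS_of_Mx x hx) h.ge h').symm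
    · exact (hdisj y hy x hx h).symm
  · refine Finset.disjoint_left.2 fun y hy hyM => ?_
    have h0 := (Finset.mem_filter.1 (Finset.mem_sdiff.1 hy).1).2
    exact ((memS y).1 (memS_of_Mx y hyM)).2.ne' h0
  · refine Finset.disjoint_left.2 fun y hy hyM => ?_
    obtain ⟨x, hx, hyx⟩ := Finset.mem_biUnion.1 hy
    obtain ⟨-, ⟨-, h₁⟩, -, h₂⟩ := (memW x hx y).1 hyx
    exact h₁.ne (congrArg Prod.fst (((memMx y).1 hyM).2 x (memS_of_Mx x hx) h₁.le h₂.le))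
end
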